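/- Assume v_k ⇀ v weakly in H¹(ℝ^N), let ξ_k ∈ ℝ^N satisfy |ξ_k| → ∞, and let V ∈ C⁰(ℝ^N) satisfy (V₂). Set V_k(x) := V(x + ξ_k). Then ‖v_k‖²_{V_k} − ‖v_k − v‖²_{V_k} → ‖v‖²_{V_∞} as k → ∞; that is, lim_{k→∞}‖v_k‖²_{V_k} − lim_{k→∞}‖v_k − v‖²_{V_k} = ‖v‖²_{V_∞} whenever these limits exist. -/

import Mathlib

open MeasureTheory Filter Topology Real
open scoped RealInnerProductSpace ENNReal NNReal

noncomputable section

/-- Euclidean space `ℝ^N`, identified with `ℂ × ℝ^{N-2}` via the first two coordinates. -/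
abbrev E (N : ℕ) := EuclideanSpace ℝ (Fin N)

/-- The linear isometry of `ℝ^N ≡ ℂ × ℝ^{N-2}` given by `(z,y) ↦ (e^{iα} z, θ y)`:
rotation by the angle `α` in the first two coordinates together with a linear isometry
`θ ∈ O(N-2)` acting on the remaining coordinates. -/
def act (N : ℕ) (hN : 2 ≤ N) (α : ℝ)
    (θ : EuclideanSpace ℝ (Fin (N - 2)) ≃ₗᵢ[ℝ] EuclideanSpace ℝ (Fin (N - 2)))
    (x : E N) : E N :=
  WithLp.toLp 2 fun i =>
    if h0 : (i : ℕ) = 0 then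
      Real.cos α * x ⟨0, by omega⟩ - Real.sin α * x ⟨1, by omega⟩
    else if h1 : (i : ℕ) = 1 then
      Real.sin α * x ⟨0, by omega⟩ + Real.cos α * x ⟨1, by omega⟩
    else
      θ (WithLp.toLp 2 fun j : Fin (N - 2) => x ⟨(j : ℕ) + 2, by have := j.isLt; omega⟩)
        ⟨(i : ℕ) - 2, by have := i.isLt; omega⟩

/-- The identity element of `O(N-2)`. -/
def idO (N : ℕ) : EuclideanSpace ℝ (Fin (N - 2)) ≃ₗᵢ[ℝ] EuclideanSpace ℝ (Fin (N - 2)) :=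
  LinearIsometryEquiv.refl ℝ _

/-- The embedding `ℂ → ℂ × ℝ^{N-2} ≡ ℝ^N`, `w ↦ (w, 0)`. -/
def embedC (N : ℕ) (hN : 2 ≤ N) (w : ℂ) : E N :=
  WithLp.toLp 2 fun i => if (i : ℕ) = 0 then w.re else if (i : ℕ) = 1 then w.im else 0

/-- Membership in the Sobolev space `H¹(ℝ^N)`. -/
def MemH1 (N : ℕ) (u : E N → ℝ) : Prop :=
  Differentiable ℝ u ∧ MemLp u 2 volume ∧ MemLp (fun x => gradient u x) 2 volume

/-- The squared norm `‖u‖_V² = ∫ (|∇u|² + V(x) u²)`. -/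
def normVSq (N : ℕ) (V : E N → ℝ) (u : E N → ℝ) : ℝ :=
  ∫ x, (‖gradient u x‖ ^ 2 + V x * u x ^ 2)

/-- The squared `H¹`-distance between `u` and `v`. -/
def H1distSq (N : ℕ) (u v : E N → ℝ) : ℝ :=
  ∫ x, (‖gradient u x - gradient v x‖ ^ 2 + (u x - v x) ^ 2)

/-- Strong convergence in `H¹(ℝ^N)`. -/
def TendstoH1 (N : ℕ) (u : ℕ → E N → ℝ) (v : E N → ℝ) : Prop :=
  Filter.Tendsto (fun k => H1distSq N (u k) v) Filter.atTop (nhds 0)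

/-- Test functions: smooth with compact support. -/
def IsTest (N : ℕ) (v : E N → ℝ) : Prop := ContDiff ℝ (⊤ : ℕ∞) v ∧ HasCompactSupport v

/-- `u` is a (weak) solution of the competitive system
`-Δuᵢ + V uᵢ = |uᵢ|^{2p-2}uᵢ + β ∑_{j≠i} |u_j|^p |uᵢ|^{p-2} uᵢ`. -/
def IsSolution (N ℓ : ℕ) (V : E N → ℝ) (β p : ℝ) (u : Fin ℓ → E N → ℝ) : Prop :=
  (∀ i, MemH1 N (u i)) ∧
  ∀ (i : Fin ℓ) (v : E N → ℝ), IsTest N v →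
    ∫ x, (⟪gradient (u i) x, gradient v x⟫ + V x * u i x * v x) =
      ∫ x, (|u i x| ^ (2 * p - 2) * u i x * v x
        + β * (∑ j ∈ Finset.univ.erase i, |u j x| ^ p) * |u i x| ^ (p - 2) * u i x * v x)

/-- `u` is a (weak) solution of the single equation `-Δu + V u = c |u|^{2p-2} u`. -/
def IsEqSolution (N : ℕ) (V : E N → ℝ) (c p : ℝ) (u : E N → ℝ) : Prop :=
  MemH1 N u ∧
  ∀ v : E N → ℝ, IsTest N v →
    ∫ x, (⟪gradient u x, gradient v x⟫ + V x * u x * v x) =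
      c * ∫ x, |u x| ^ (2 * p - 2) * u x * v x

/-- The pinwheel symmetries: `u₁(e^{2πi/n} z, θ y) = u₁(z,y)` for every `θ ∈ O(N-2)`,
and `u_{j+1}(z,y) = u₁(e^{2πij/(ℓn)} z, y)`. -/
def Pinwheel (N : ℕ) (hN : 2 ≤ N) (n ℓ : ℕ) (hℓ : 0 < ℓ) (u : Fin ℓ → E N → ℝ) : Prop :=
  (∀ θ x, u ⟨0, hℓ⟩ (act N hN (2 * π / (n : ℝ)) θ x) = u ⟨0, hℓ⟩ x) ∧
  (∀ (j : Fin ℓ) (x : E N),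
    u j x = u ⟨0, hℓ⟩ (act N hN (2 * π * ((j : ℕ) : ℝ) / ((ℓ : ℝ) * (n : ℝ))) (idO N) x))

/-- `G_n`-invariance: `u(e^{2πi/n} z, θ y) = u(z,y)` for every `θ ∈ O(N-2)`. -/
def GInv (N : ℕ) (hN : 2 ≤ N) (n : ℕ) (u : E N → ℝ) : Prop :=
  ∀ θ x, u (act N hN (2 * π / (n : ℝ)) θ x) = u x

/-- `τ_n`-equivariance: `u(e^{πi/n} z, y) = -u(z,y)` and `u(z, θ y) = u(z,y)`. -/
def TauInv (N : ℕ) (hN : 2 ≤ N) (n : ℕ) (u : E N → ℝ) : Prop :=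
  (∀ x, u (act N hN (π / (n : ℝ)) (idO N) x) = -u x) ∧
  (∀ θ x, u (act N hN 0 θ x) = u x)

/-- A radial function. -/
def Radial (N : ℕ) (u : E N → ℝ) : Prop := ∀ x y : E N, ‖x‖ = ‖y‖ → u x = u y

/-- Hypothesis `(V₂)`: `0 < inf V` and `V(x) → V_∞ > 0` as `|x| → ∞`. -/
def HypV2 (N : ℕ) (V : E N → ℝ) (Vinf : ℝ) : Prop :=
  (∃ c > 0, ∀ x, c ≤ V x) ∧ 0 < Vinf ∧
    Filter.Tendsto V (Filter.cocompact (E N)) (nhds Vinf)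

/-- Hypothesis `(V₃ⁿ)`. -/
def HypV3 (N ℓ n : ℕ) (V : E N → ℝ) (Vinf : ℝ) : Prop :=
  ∃ C₀ > 0, ∃ R₀ > 0, ∃ lam : ℝ,
    0 < lam ∧ lam < 2 * Real.sin (π / ((ℓ : ℝ) * (n : ℝ))) ∧
    ∀ x : E N, R₀ ≤ ‖x‖ → V x ≤ Vinf - C₀ * Real.exp (-lam * Real.sqrt Vinf * ‖x‖)

/-- The energy functional `𝒥` of the system. -/
def energy (N ℓ : ℕ) (V : E N → ℝ) (β p : ℝ) (u : Fin ℓ → E N → ℝ) : ℝ :=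
  (1 / 2) * ∑ i, normVSq N V (u i)
    - (1 / (2 * p)) * ∑ i, ∫ x, |u i x| ^ (2 * p)
    - (β / (2 * p)) * ∑ i, ∑ j ∈ Finset.univ.erase i, ∫ x, |u i x| ^ p * |u j x| ^ p

/-- The energy functional `J` of a single equation. -/
def Jfun (N : ℕ) (V : E N → ℝ) (p : ℝ) (u : E N → ℝ) : ℝ :=
  (1 / 2) * normVSq N V u - (1 / (2 * p)) * ∫ x, |u x| ^ (2 * p)

/-- The derivative of `𝒥` at `u` in the direction `v`. -/
def dJ (N ℓ : ℕ) (V : E N → ℝ) (β p : ℝ) (u v : Fin ℓ → E N → ℝ) : ℝ :=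
  ∑ i, ((∫ x, (⟪gradient (u i) x, gradient (v i) x⟫ + V x * u i x * v i x))
    - (∫ x, |u i x| ^ (2 * p - 2) * u i x * v i x)
    - β * ∑ j ∈ Finset.univ.erase i, ∫ x, |u j x| ^ p * |u i x| ^ (p - 2) * u i x * v i x)

/-- The derivative of `Ψ(u) = 𝒥'(u)u` at `u` in the direction `v`. -/
def dPsi (N ℓ : ℕ) (V : E N → ℝ) (β p : ℝ) (u v : Fin ℓ → E N → ℝ) : ℝ :=
  ∑ i, (2 * (∫ x, (⟪gradient (u i) x, gradient (v i) x⟫ + V x * u i x * v i x))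
    - 2 * p * (∫ x, |u i x| ^ (2 * p - 2) * u i x * v i x)
    - 2 * p * β *
        ∑ j ∈ Finset.univ.erase i, ∫ x, |u j x| ^ p * |u i x| ^ (p - 2) * u i x * v i x)

/-- The Nehari set `𝒩^{φ_n}`. -/
def InNehari (N : ℕ) (hN : 2 ≤ N) (ℓ n : ℕ) (hℓ : 0 < ℓ) (V : E N → ℝ) (β p : ℝ)
    (u : Fin ℓ → E N → ℝ) : Prop :=
  (∀ i, MemH1 N (u i)) ∧ Pinwheel N hN n ℓ hℓ u ∧
  ∀ i, u i ≠ 0 ∧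
    normVSq N V (u i) =
      (∫ x, |u i x| ^ (2 * p)) +
        β * ∑ j ∈ Finset.univ.erase i, ∫ x, |u i x| ^ p * |u j x| ^ p

/-- `c^{φ_n} := inf_{𝒩^{φ_n}} 𝒥`. -/
def cPhi (N : ℕ) (hN : 2 ≤ N) (ℓ n : ℕ) (hℓ : 0 < ℓ) (V : E N → ℝ) (β p : ℝ) : ℝ :=
  sInf (energy N ℓ V β p '' {u | InNehari N hN ℓ n hℓ V β p u})

/-- The ground state energy `𝔠_∞` of the limit problem `-Δu + V_∞ u = |u|^{2p-2}u`. -/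
def cInfty (N : ℕ) (p Vinf : ℝ) : ℝ :=
  sInf (Jfun N (fun _ => Vinf) p ''
    {u | MemH1 N u ∧ u ≠ 0 ∧ normVSq N (fun _ => Vinf) u = ∫ x, |u x| ^ (2 * p)})

/-- The least energy `𝔠^{G_n}` on the `G_n`-invariant Nehari manifold. -/
def cGn (N : ℕ) (hN : 2 ≤ N) (n : ℕ) (V : E N → ℝ) (p : ℝ) : ℝ :=
  sInf (Jfun N V p ''
    {u | MemH1 N u ∧ u ≠ 0 ∧ GInv N hN n u ∧ normVSq N V u = ∫ x, |u x| ^ (2 * p)})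

/-- A least energy fully nontrivial (positive) solution of the system satisfying the
pinwheel symmetries. -/
def IsLeastEnergySol (N : ℕ) (hN : 2 ≤ N) (ℓ n : ℕ) (hℓ : 0 < ℓ) (V : E N → ℝ) (β p : ℝ)
    (u : Fin ℓ → E N → ℝ) : Prop :=
  IsSolution N ℓ V β p u ∧ (∀ i x, 0 < u i x) ∧ Pinwheel N hN n ℓ hℓ u ∧
  ∀ w, IsSolution N ℓ V β p w → (∀ i x, 0 < w i x) → Pinwheel N hN n ℓ hℓ w →
    energy N ℓ V β p u ≤ energy N ℓ V β p w

/-- The set `𝒲^n_ℓ` of weak `(n,ℓ)`-pinwheel partitions. -/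
def WeakPartition (N : ℕ) (hN : 2 ≤ N) (ℓ n : ℕ) (hℓ : 0 < ℓ) (V : E N → ℝ) (p : ℝ) :
    Set (Fin ℓ → E N → ℝ) :=
  {u | (∀ i, MemH1 N (u i)) ∧ Pinwheel N hN n ℓ hℓ u ∧
    (∀ i, u i ≠ 0 ∧ normVSq N V (u i) = ∫ x, |u i x| ^ (2 * p)) ∧
    ∀ i j, i ≠ j → ∀ x, u i x * u j x = 0}

/-- `ĉ^{φ_n} := inf_{𝒲^n_ℓ} (p-1)/(2p) ∑ ‖uᵢ‖_V²`. -/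
def hatC (N : ℕ) (hN : 2 ≤ N) (ℓ n : ℕ) (hℓ : 0 < ℓ) (V : E N → ℝ) (p : ℝ) : ℝ :=
  sInf ((fun u : Fin ℓ → E N → ℝ => (p - 1) / (2 * p) * ∑ i, normVSq N V (u i)) ''
    WeakPartition N hN ℓ n hℓ V p)

/-- The `G_n`-invariant Nehari set `𝓜_Ω` in `H¹₀(Ω)`. -/
def MOmega (N : ℕ) (hN : 2 ≤ N) (n : ℕ) (V : E N → ℝ) (p : ℝ) (Ω : Set (E N)) :
    Set (E N → ℝ) :=
  {u | MemH1 N u ∧ u ≠ 0 ∧ (∀ x ∉ Ω, u x = 0) ∧ GInv N hN n u ∧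
    normVSq N V u = ∫ x, |u x| ^ (2 * p)}

/-- `𝔠_Ω := inf_{𝓜_Ω} (p-1)/(2p) ‖u‖_V²`. -/
def cOmega (N : ℕ) (hN : 2 ≤ N) (n : ℕ) (V : E N → ℝ) (p : ℝ) (Ω : Set (E N)) : ℝ :=
  sInf ((fun u => (p - 1) / (2 * p) * normVSq N V u) '' MOmega N hN n V p Ω)

/-- An `(n,ℓ)`-pinwheel partition of `ℝ^N`. -/
def IsPinwheelPartition (N : ℕ) (hN : 2 ≤ N) (ℓ n : ℕ) (hℓ : 0 < ℓ)
    (Ω : Fin ℓ → Set (E N)) : Prop :=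
  (∀ j, (Ω j).Nonempty ∧ IsOpen (Ω j)) ∧
  (∀ i j, i ≠ j → Ω i ∩ Ω j = ∅) ∧
  (∀ j : Fin ℓ, Ω j =
    {x | act N hN (2 * π * ((j : ℕ) : ℝ) / ((ℓ : ℝ) * (n : ℝ))) (idO N) x ∈ Ω ⟨0, hℓ⟩}) ∧
  (∀ θ, ∀ x ∈ Ω ⟨0, hℓ⟩, act N hN (2 * π / (n : ℝ)) θ x ∈ Ω ⟨0, hℓ⟩)

/-- An optimal `(n,ℓ)`-pinwheel partition for the equation `-Δu + Vu = |u|^{2p-2}u`. -/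
def IsOptimalPinwheelPartition (N : ℕ) (hN : 2 ≤ N) (ℓ n : ℕ) (hℓ : 0 < ℓ)
    (V : E N → ℝ) (p : ℝ) (Ω : Fin ℓ → Set (E N)) : Prop :=
  IsPinwheelPartition N hN ℓ n hℓ Ω ∧
  (∀ j, ∃ u ∈ MOmega N hN n V p (Ω j),
    (p - 1) / (2 * p) * normVSq N V u = cOmega N hN n V p (Ω j)) ∧
  (∑ j, cOmega N hN n V p (Ω j)) =
    sInf {s | ∃ Θ : Fin ℓ → Set (E N), IsPinwheelPartition N hN ℓ n hℓ Θ ∧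
      s = ∑ j, cOmega N hN n V p (Θ j)}

/-- The Nehari manifold `𝓜^{τ_n}` of `τ_n`-equivariant functions. -/
def MTau (N : ℕ) (hN : 2 ≤ N) (n : ℕ) (V : E N → ℝ) (p : ℝ) : Set (E N → ℝ) :=
  {u | MemH1 N u ∧ u ≠ 0 ∧ TauInv N hN n u ∧ normVSq N V u = ∫ x, |u x| ^ (2 * p)}

/-- The sum of `n` truncated copies of `ω` placed at the vertices `R e^{2πij/n}` of a
regular `n`-gon in `ℂ × {0}`; the truncation radius is `ϱ R`. -/
def bumpSum (N : ℕ) (hN : 2 ≤ N) (n : ℕ) (ω χ : E N → ℝ) (ϱ R : ℝ) (x : E N) : ℝ :=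
  ∑ j ∈ Finset.range n,
    χ ((ϱ * R)⁻¹ •
        (x - R • embedC N hN (Complex.exp (((2 * π * (j : ℝ) / (n : ℝ) : ℝ) : ℂ) * Complex.I)))) *
      ω (x - R • embedC N hN (Complex.exp (((2 * π * (j : ℝ) / (n : ℝ) : ℝ) : ℂ) * Complex.I)))

/-- The test `ℓ`-tuple `w_R` built from translated truncations of `ω`, scaled by `t`. -/
def testTuple (N : ℕ) (hN : 2 ≤ N) (ℓ n : ℕ) (ω χ : E N → ℝ) (ϱ R t : ℝ) :
    Fin ℓ → E N → ℝ :=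
  fun i x => t * bumpSum N hN n ω χ ϱ R
    (act N hN (2 * π * ((i : ℕ) : ℝ) / ((ℓ : ℝ) * (n : ℝ))) (idO N) x)

end


/-- Gaussian weight. -/
noncomputable def ga {N : ℕ} (z : E N) : ℝ := Real.exp (-(‖z‖ ^ 2) / 2)

lemma ga_pos {N : ℕ} (z : E N) : 0 < ga z := Real.exp_pos _

lemma ga_le_one {N : ℕ} (z : E N) : ga z ≤ 1 := by
  unfold ga
  apply Real.exp_le_one_iff.2
  have := sq_nonneg ‖z‖
  linarith

lemma ga_cont {N : ℕ} : Continuous (ga : E N → ℝ) := by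
  unfold ga; fun_prop

lemma pow_ga_le {N : ℕ} (k : ℕ) (z : E N) :
    ‖z‖ ^ k * ga z ≤ (k.factorial * Real.exp 1) * Real.exp (-(1/4) * ‖z‖ ^ 2) := by
  have h1 : ‖z‖ ^ k ≤ k.factorial * Real.exp ‖z‖ := by
    have := Real.pow_div_factorial_le_exp ‖z‖ (norm_nonneg _) k
    rw [div_le_iff₀ (by positivity)] at this
    linarith
  have h2 : Real.exp ‖z‖ * ga z ≤ Real.exp 1 * Real.exp (-(1/4) * ‖z‖ ^ 2) := by
    unfold ga
    rw [← Real.exp_add, ← Real.exp_add]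
    apply Real.exp_le_exp.2
    nlinarith [sq_nonneg (‖z‖ / 2 - 1)]
  calc ‖z‖ ^ k * ga z ≤ (k.factorial * Real.exp ‖z‖) * ga z := by
        gcongr; exact (ga_pos z).le
    _ = k.factorial * (Real.exp ‖z‖ * ga z) := by ring
    _ ≤ k.factorial * (Real.exp 1 * Real.exp (-(1/4) * ‖z‖ ^ 2)) := by gcongr
    _ = _ := by ring

lemma gauss_base {N : ℕ} (b : ℝ) (hb : 0 < b) :
    Integrable (fun z : E N => Real.exp (-b * ‖z‖ ^ 2)) := by
  have := (GaussianFourier.integrable_cexp_neg_mul_sq_norm_add (V := E N) (b := (b : ℂ))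
    (by simpa) 0 0).norm
  refine this.congr (ae_of_all _ fun z => ?_)
  simp only [Complex.norm_exp]
  congr 1
  simp [← Complex.ofReal_pow]

lemma gauss_int {N : ℕ} (k : ℕ) : Integrable (fun z : E N => ‖z‖ ^ k * ga z) := by
  refine ((gauss_base (N := N) (1/4) (by norm_num)).const_mul
    (k.factorial * Real.exp 1)).mono' ?_ (ae_of_all _ fun z => ?_)
  · exact ((continuous_norm.pow k).mul ga_cont).aestronglyMeasurable
  · rw [Real.norm_of_nonneg (mul_nonneg (by positivity) (ga_pos z).le)]
    exact pow_ga_le k z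

/-- change of variables -/
lemma cov {N : ℕ} {F : Type*} [NormedAddCommGroup F] [NormedSpace ℝ F]
    (f : E N → F) (x : E N) (s : ℝ) :
    ∫ z, f (x - s • z) = |(s ^ N)⁻¹| • ∫ y, f y := by
  have := Measure.integral_comp_smul (volume : Measure (E N)) (fun u => f (x - u)) s
  rw [this, integral_sub_left_eq_self f volume x]
  simp

lemma cov_int {N : ℕ} {F : Type*} [NormedAddCommGroup F]
    {f : E N → F} (hf : Integrable f) (x : E N) {s : ℝ} (hs : s ≠ 0) :
    Integrable (fun z => f (x - s • z)) := by
  have : Integrable (fun u => f (x - u)) := hf.comp_sub_left x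
  exact this.comp_smul hs

lemma loc_bound {N : ℕ} {g : E N → ℝ} (hg : Continuous g) (hg2 : MemLp g 2 volume)
    (j : ℕ) (x₀ : E N) :
    ∃ B : ℝ, 0 ≤ B ∧ ∀ x ∈ Metric.ball x₀ 1, ∀ s : ℝ, 0 < s →
      Integrable (fun z => ‖z‖ ^ j * (ga z * |g (x - s • z)|)) ∧
      ∫ z, ‖z‖ ^ j * (ga z * |g (x - s • z)|) ≤ B := by
  obtain ⟨M, hM⟩ := (isCompact_closedBall x₀ 2).exists_bound_of_continuousOn hg.continuousOn
  have hM0 : 0 ≤ M := (norm_nonneg _).trans (hM x₀ (by simp))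
  have hsq : Integrable (fun y => g y ^ 2) := hg2.integrable_sq
  refine ⟨M * (∫ z : E N, ‖z‖ ^ j * ga z) + (∫ z : E N, ‖z‖ ^ (2 * j + N) * ga z)
      + ∫ y, g y ^ 2, ?_, ?_⟩
  · have h1 : 0 ≤ ∫ z : E N, ‖z‖ ^ j * ga z :=
      integral_nonneg fun z => mul_nonneg (by positivity) (ga_pos z).le
    have h2 : 0 ≤ ∫ z : E N, ‖z‖ ^ (2 * j + N) * ga z :=
      integral_nonneg fun z => mul_nonneg (by positivity) (ga_pos z).le
    have h3 : 0 ≤ ∫ y, g y ^ 2 := integral_nonneg fun z => by positivity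
    positivity
  intro x hx s hs
  have hI : Integrable (fun z : E N => M * (‖z‖ ^ j * ga z) + ‖z‖ ^ (2 * j + N) * ga z
      + s ^ N * g (x - s • z) ^ 2) :=
    (((gauss_int j).const_mul M).add (gauss_int _)).add
      ((cov_int hsq x hs.ne').const_mul (s ^ N))
  have hpt : ∀ z : E N, ‖z‖ ^ j * (ga z * |g (x - s • z)|) ≤ M * (‖z‖ ^ j * ga z)
      + ‖z‖ ^ (2 * j + N) * ga z + s ^ N * g (x - s • z) ^ 2 := by
    intro z
    have hga := ga_pos z
    have hga1 := ga_le_one z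
    have e1 : 0 ≤ M * (‖z‖ ^ j * ga z) := by positivity
    have e2 : 0 ≤ ‖z‖ ^ (2 * j + N) * ga z := by positivity
    have e3 : 0 ≤ s ^ N * g (x - s • z) ^ 2 := by positivity
    by_cases hz : s * ‖z‖ ≤ 1
    · have : |g (x - s • z)| ≤ M := by
        apply hM
        rw [Metric.mem_closedBall, dist_eq_norm]
        have h1 : ‖x - x₀‖ < 1 := by simpa [dist_eq_norm] using hx
        calc ‖x - s • z - x₀‖ = ‖(x - x₀) - s • z‖ := by congr 1; abel
          _ ≤ ‖x - x₀‖ + ‖s • z‖ := norm_sub_le _ _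
          _ ≤ 2 := by rw [norm_smul, Real.norm_of_nonneg hs.le]; linarith
      have : ‖z‖ ^ j * (ga z * |g (x - s • z)|) ≤ ‖z‖ ^ j * (ga z * M) := by gcongr
      nlinarith
    · push Not at hz
      have h1 : 1 ≤ s ^ N * ‖z‖ ^ N := by
        rw [← mul_pow]; exact one_le_pow₀ hz.le
      set G := |g (x - s • z)| with hG
      have hG0 : 0 ≤ G := abs_nonneg _
      have hGs : g (x - s • z) ^ 2 = G ^ 2 := by rw [hG, sq_abs]
      rw [hGs] at e3 ⊢
      set A := ‖z‖ ^ j * ga z with hA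
      have hA0 : 0 ≤ A := by positivity
      have k1 : A ^ 2 * ‖z‖ ^ N ≤ ‖z‖ ^ (2 * j + N) * ga z := by
        have : ga z ^ 2 ≤ ga z := by nlinarith
        calc A ^ 2 * ‖z‖ ^ N = ‖z‖ ^ (2 * j + N) * ga z ^ 2 := by rw [hA]; ring
          _ ≤ _ := by gcongr
      have k2 : A * G ≤ A ^ 2 * ‖z‖ ^ N + s ^ N * G ^ 2 := by
        set a := ‖z‖ ^ N
        set b := s ^ N
        have ha : 0 ≤ a := by positivity
        have hb : 0 < b := by positivity
        -- AG ≤ A G √(ab)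
        have t : (A * G) ^ 2 ≤ (A ^ 2 * a + b * G ^ 2) ^ 2 := by
          have t1 : (A * G) ^ 2 ≤ (A ^ 2 * a) * (b * G ^ 2) := by
            calc (A * G) ^ 2 = (A * G) ^ 2 * 1 := by ring
              _ ≤ (A * G) ^ 2 * (b * a) := by gcongr
              _ = _ := by ring
          have p1 : 0 ≤ A ^ 2 * a := by positivity
          have p2 : 0 ≤ b * G ^ 2 := by positivity
          nlinarith
        exact abs_le_of_sq_le_sq' t (by positivity) |>.2
      calc ‖z‖ ^ j * (ga z * G) = A * G := by rw [hA]; ring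
        _ ≤ _ := by linarith
  have hcont : Continuous (fun z : E N => ‖z‖ ^ j * (ga z * |g (x - s • z)|)) := by
    have := @ga_cont N
    fun_prop
  have hint : Integrable (fun z => ‖z‖ ^ j * (ga z * |g (x - s • z)|)) :=
    hI.mono' hcont.aestronglyMeasurable (ae_of_all _ fun z => by
      rw [Real.norm_of_nonneg]
      · exact hpt z
      · have := ga_pos z; positivity)
  refine ⟨hint, (integral_mono hint hI hpt).trans (le_of_eq ?_)⟩
  rw [integral_add, integral_add, integral_const_mul, integral_const_mul,
    cov (fun y => g y ^ 2) x s]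
  · have : 0 < s ^ N := by positivity
    rw [abs_of_pos (by positivity), smul_eq_mul]
    field_simp
  · exact (gauss_int j).const_mul M
  · exact gauss_int _
  · exact ((gauss_int j).const_mul M).add (gauss_int _)
  · exact ((cov_int hsq x hs.ne').const_mul (s ^ N))

lemma ga_grad {N : ℕ} (s : ℝ) (x y : E N) (c : ℝ) :
    HasFDerivAt (fun x : E N => ga (s⁻¹ • (x - y)) * c)
      (-(s⁻¹ * (ga (s⁻¹ • (x - y)) * c)) • innerSL ℝ (s⁻¹ • (x - y))) x := by
  unfold ga
  have h1 : HasFDerivAt (fun x : E N => s⁻¹ • (x - y)) (s⁻¹ • ContinuousLinearMap.id ℝ (E N)) x :=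
    ((hasFDerivAt_id x).sub_const y).const_smul s⁻¹
  have h2 := (((h1.norm_sq).neg.mul_const (1/2 : ℝ)).exp).mul_const c
  have e : (fun x : E N => Real.exp (-(‖s⁻¹ • (x - y)‖ ^ 2) / 2) * c)
    = fun x : E N => Real.exp (-(‖s⁻¹ • (x - y)‖ ^ 2) * (1/2)) * c := by
    funext x; ring_nf
  rw [e]
  refine h2.congr_fderiv ?_
  ext u
  simp
  ring_nf

lemma D1 {N : ℕ} {g : E N → ℝ} (hg : Continuous g) (hg2 : MemLp g 2 volume)
    {s : ℝ} (hs : 0 < s) (x₀ : E N) :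
    HasFDerivAt (fun x => ∫ z, ga z * g (x - s • z))
      (-s⁻¹ • innerSL ℝ (∫ z, (ga z * g (x₀ - s • z)) • z)) x₀ := by
  have hsq : Integrable (fun y => g y ^ 2) := hg2.integrable_sq
  have hgc := @ga_cont N
  have e1 : (fun x => ∫ z, ga z * g (x - s • z)) =
      fun x => |(s ^ N)⁻¹| • ∫ y, ga (s⁻¹ • (x - y)) * g y := by
    funext x
    rw [← cov (fun y => ga (s⁻¹ • (x - y)) * g y) x s]
    congr 1; funext z
    simp [smul_smul, hs.ne']
  have e2 : (∫ z, (ga z * g (x₀ - s • z)) • z) =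
      |(s ^ N)⁻¹| • ∫ y, (ga (s⁻¹ • (x₀ - y)) * g y) • (s⁻¹ • (x₀ - y)) := by
    rw [← cov (fun y => (ga (s⁻¹ • (x₀ - y)) * g y) • (s⁻¹ • (x₀ - y))) x₀ s]
    congr 1; funext z
    simp [smul_smul, hs.ne']
  have hI0 : Integrable (fun y => Real.exp (-(1/8) * ‖s⁻¹ • (x₀ - y)‖ ^ 2) ^ 2 + g y ^ 2) := by
    refine Integrable.add ?_ hsq
    have h := ((gauss_base (N := N) (1/4) (by norm_num)).comp_smul (inv_ne_zero hs.ne')).comp_sub_left x₀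
    refine h.congr (ae_of_all _ fun y => ?_)
    simp only
    rw [← Real.exp_nat_mul]; congr 1; push_cast; ring
  have hbd : ∀ (k : ℕ) (x : E N), x ∈ Metric.ball x₀ s → ∀ y, ‖s⁻¹ • (x - y)‖ ^ k *
      (ga (s⁻¹ • (x - y)) * |g y|) ≤ (k.factorial * Real.exp 1 * Real.exp (1/4)) *
        (Real.exp (-(1/8) * ‖s⁻¹ • (x₀ - y)‖ ^ 2) ^ 2 + g y ^ 2) := by
    intro k x hx y
    set u := s⁻¹ • (x - y)
    set u0 := s⁻¹ • (x₀ - y)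
    have hu : ‖u0 - u‖ ≤ 1 := by
      have : u0 - u = s⁻¹ • (x₀ - x) := by simp only [u, u0]; rw [← smul_sub]; congr 1; abel
      rw [this, norm_smul, norm_inv, Real.norm_of_nonneg hs.le, inv_mul_le_iff₀ hs]
      rw [Metric.mem_ball, dist_comm, dist_eq_norm] at hx
      linarith
    have hu2 : ‖u0‖ ^ 2 ≤ 2 * ‖u‖ ^ 2 + 2 := by
      have : ‖u0‖ ≤ ‖u‖ + 1 := by
        calc ‖u0‖ = ‖u + (u0 - u)‖ := by congr 1; abel
          _ ≤ _ := (norm_add_le _ _).trans (by linarith)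
      nlinarith [norm_nonneg u0, norm_nonneg u, sq_nonneg (‖u‖ - 1)]
    have h1 := pow_ga_le k u
    have h2 : Real.exp (-(1/4) * ‖u‖ ^ 2) ≤ Real.exp (1/4) * Real.exp (-(1/8) * ‖u0‖ ^ 2) := by
      rw [← Real.exp_add]; apply Real.exp_le_exp.2; linarith
    set X := Real.exp (-(1/8) * ‖u0‖ ^ 2)
    have hX : 0 < X := Real.exp_pos _
    have h3 : X * |g y| ≤ X ^ 2 + g y ^ 2 := by
      rw [← sq_abs (g y)]
      nlinarith [sq_nonneg (X - |g y|), abs_nonneg (g y), mul_nonneg hX.le (abs_nonneg (g y))]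
    calc ‖u‖ ^ k * (ga u * |g y|) = (‖u‖ ^ k * ga u) * |g y| := by ring
      _ ≤ ((k.factorial * Real.exp 1) * (Real.exp (1/4) * X)) * |g y| := by
        refine mul_le_mul_of_nonneg_right (h1.trans ?_) (abs_nonneg _)
        gcongr
      _ = (k.factorial * Real.exp 1 * Real.exp (1/4)) * (X * |g y|) := by ring
      _ ≤ _ := by gcongr
  have hx0 : x₀ ∈ Metric.ball x₀ s := Metric.mem_ball_self hs
  have key := hasFDerivAt_integral_of_dominated_of_fderiv_le (𝕜 := ℝ) (μ := (volume : Measure (E N)))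
    (F := fun x y => ga (s⁻¹ • (x - y)) * g y)
    (F' := fun x y => -(s⁻¹ * (ga (s⁻¹ • (x - y)) * g y)) • innerSL ℝ (s⁻¹ • (x - y)))
    (x₀ := x₀) (s := Metric.ball x₀ s)
    (bound := fun y => s⁻¹ * ((Nat.factorial 1 * Real.exp 1 * Real.exp (1/4)) *
        (Real.exp (-(1/8) * ‖s⁻¹ • (x₀ - y)‖ ^ 2) ^ 2 + g y ^ 2)))
    (Metric.ball_mem_nhds _ hs)
    (Eventually.of_forall fun x => Continuous.aestronglyMeasurable (by fun_prop))
    ((hI0.const_mul (Nat.factorial 0 * Real.exp 1 * Real.exp (1/4))).mono'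
      (Continuous.aestronglyMeasurable (by fun_prop)) (ae_of_all _ fun y => by
        have := hbd 0 x₀ hx0 y
        rw [norm_mul, Real.norm_of_nonneg (ga_pos _).le, Real.norm_eq_abs]
        simpa using this))
    (Continuous.aestronglyMeasurable (by fun_prop))
    (ae_of_all _ fun y x hx => by
      have := hbd 1 x hx y
      rw [norm_smul, norm_neg, norm_mul, norm_mul, Real.norm_of_nonneg (inv_nonneg.2 hs.le),
        Real.norm_of_nonneg (ga_pos _).le, innerSL_apply_norm, Real.norm_eq_abs, mul_assoc]
      refine mul_le_mul_of_nonneg_left ?_ (inv_nonneg.2 hs.le)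
      linarith)
    ((hI0.const_mul _).const_mul _)
    (ae_of_all _ fun y x hx => ga_grad s x y (g y))
  rw [e1]
  refine (key.const_smul |(s ^ N)⁻¹|).congr_fderiv ?_
  have hint : Integrable (fun y => (ga (s⁻¹ • (x₀ - y)) * g y) • (s⁻¹ • (x₀ - y))) := by
    refine (hI0.const_mul (Nat.factorial 1 * Real.exp 1 * Real.exp (1/4))).mono'
      (Continuous.aestronglyMeasurable (by fun_prop)) (ae_of_all _ fun y => ?_)
    have := hbd 1 x₀ hx0 y
    rw [norm_smul, norm_mul, Real.norm_of_nonneg (ga_pos _).le, Real.norm_eq_abs]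
    linarith
  rw [e2, map_smul, ← ContinuousLinearMap.integral_comp_comm _ hint, smul_comm, ← integral_smul]
  rw [← integral_smul, ← integral_smul]
  congr 1; funext y
  simp only [map_smul, smul_smul]
  congr 1; ring

/-- The resolvent potential of `g`. -/
noncomputable def wf {N : ℕ} (g : E N → ℝ) (x : E N) : ℝ :=
  ∫ s in Set.Ioi (0:ℝ), (s * Real.exp (-(1/2) * s ^ 2)) * ∫ z, ga z * g (x - s • z)

/-- The gradient of the resolvent potential of `g`. -/
noncomputable def Gf {N : ℕ} (g : E N → ℝ) (x : E N) : E N :=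
  -∫ s in Set.Ioi (0:ℝ), Real.exp (-(1/2) * s ^ 2) • ∫ z, (ga z * g (x - s • z)) • z

lemma meas_q {N : ℕ} {g : E N → ℝ} (hg : Continuous g) (x : E N) :
    StronglyMeasurable (fun s : ℝ => ∫ z, ga z * g (x - s • z)) := by
  have hc : Continuous (fun p : ℝ × E N => ga p.2 * g (x - p.1 • p.2)) := by
    have := @ga_cont N
    fun_prop
  exact hc.stronglyMeasurable.integral_prod_right

lemma meas_q' {N : ℕ} {g : E N → ℝ} (hg : Continuous g) (x : E N) :
    StronglyMeasurable (fun s : ℝ => ∫ z, (ga z * g (x - s • z)) • z) := by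
  have hc : Continuous (fun p : ℝ × E N => (ga p.2 * g (x - p.1 • p.2)) • p.2) := by
    have := @ga_cont N
    fun_prop
  exact hc.stronglyMeasurable.integral_prod_right

lemma Gf_int {N : ℕ} {g : E N → ℝ} (hg : Continuous g) (hg2 : MemLp g 2 volume) (x : E N) :
    Integrable (fun s : ℝ => Real.exp (-(1/2) * s ^ 2) • ∫ z, (ga z * g (x - s • z)) • z)
      (volume.restrict (Set.Ioi (0:ℝ))) := by
  obtain ⟨B, hB0, hB⟩ := loc_bound hg hg2 1 x
  refine (((integrable_exp_neg_mul_sq (b := 1/2) (by norm_num)).restrict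
    (s := Set.Ioi 0)).mul_const B).mono' ?_ ?_
  · have := meas_q' hg x
    exact ((by fun_prop : Continuous (fun s : ℝ => Real.exp (-(1/2) * s ^ 2))).stronglyMeasurable.smul
      this).aestronglyMeasurable
  · filter_upwards [ae_restrict_mem measurableSet_Ioi] with s hs
    rw [norm_smul, Real.norm_of_nonneg (Real.exp_pos _).le]
    refine mul_le_mul_of_nonneg_left ?_ (Real.exp_pos _).le
    refine (norm_integral_le_integral_norm _).trans
      (le_trans (le_of_eq ?_) (hB x (Metric.mem_ball_self one_pos) s hs).2)
    congr 1; funext z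
    rw [norm_smul, norm_mul, Real.norm_of_nonneg (ga_pos z).le, Real.norm_eq_abs, pow_one, mul_comm]

lemma Gf_int_inner {N : ℕ} {g : E N → ℝ} (hg : Continuous g) (hg2 : MemLp g 2 volume) (x : E N)
    {s : ℝ} (hs : 0 < s) :
    Integrable (fun z => (ga z * g (x - s • z)) • z) := by
  obtain ⟨B, hB0, hB⟩ := loc_bound hg hg2 1 x
  refine (hB x (Metric.mem_ball_self one_pos) s hs).1.mono' ?_ (ae_of_all _ fun z => ?_)
  · have := @ga_cont N
    exact Continuous.aestronglyMeasurable (by fun_prop)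
  · rw [norm_smul, norm_mul, Real.norm_of_nonneg (ga_pos z).le, Real.norm_eq_abs, pow_one, mul_comm]

lemma D2 {N : ℕ} {g : E N → ℝ} (hg : Continuous g) (hg2 : MemLp g 2 volume) (x₀ : E N) :
    HasGradientAt (wf g) (Gf g x₀) x₀ := by
  obtain ⟨B0, hB00, hB0⟩ := loc_bound hg hg2 0 x₀
  obtain ⟨B, hB'0, hB⟩ := loc_bound hg hg2 1 x₀
  have hx0 : x₀ ∈ Metric.ball x₀ 1 := Metric.mem_ball_self one_pos
  have hc1 : Continuous (fun s : ℝ => s * Real.exp (-(1/2) * s ^ 2)) := by fun_prop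
  have key := hasFDerivAt_integral_of_dominated_of_fderiv_le (𝕜 := ℝ)
    (μ := volume.restrict (Set.Ioi (0:ℝ)))
    (F := fun x s => (s * Real.exp (-(1/2) * s ^ 2)) * ∫ z, ga z * g (x - s • z))
    (F' := fun x s => (s * Real.exp (-(1/2) * s ^ 2)) •
      (-s⁻¹ • innerSL ℝ (∫ z, (ga z * g (x - s • z)) • z)))
    (x₀ := x₀) (s := Metric.ball x₀ 1)
    (bound := fun s => Real.exp (-(1/2) * s ^ 2) * B)
    (Metric.ball_mem_nhds _ one_pos)
    (Eventually.of_forall fun x => (hc1.stronglyMeasurable.mul (meas_q hg x)).aestronglyMeasurable)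
    (by
      refine (((integrable_mul_exp_neg_mul_sq (b := 1/2) (by norm_num)).restrict
        (s := Set.Ioi 0)).mul_const B0).mono'
        (hc1.stronglyMeasurable.mul (meas_q hg x₀)).aestronglyMeasurable ?_
      filter_upwards [ae_restrict_mem measurableSet_Ioi] with s hs
      have hs' : (0:ℝ) < s := hs
      rw [norm_mul, Real.norm_of_nonneg (by positivity)]
      refine mul_le_mul_of_nonneg_left ?_ (by positivity)
      refine (norm_integral_le_integral_norm _).trans
        (le_trans (le_of_eq ?_) (hB0 x₀ hx0 s hs).2)
      congr 1; funext z
      rw [norm_mul, Real.norm_of_nonneg (ga_pos z).le, Real.norm_eq_abs, pow_zero, one_mul])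
    (by
      have h1 : StronglyMeasurable (fun s : ℝ => innerSL ℝ (∫ z, (ga z * g (x₀ - s • z)) • z)) :=
        (innerSL ℝ : E N →L⋆[ℝ] _).continuous.comp_stronglyMeasurable (meas_q' hg x₀)
      have h2 : StronglyMeasurable (fun s : ℝ => -s⁻¹) :=
        (measurable_inv.neg).stronglyMeasurable
      exact (hc1.stronglyMeasurable.smul (h2.smul h1)).aestronglyMeasurable)
    (by
      filter_upwards [ae_restrict_mem measurableSet_Ioi] with s hs x hx
      have hs' : (0:ℝ) < s := hs
      rw [smul_smul, norm_smul, innerSL_apply_norm]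
      have : ‖s * Real.exp (-(1/2) * s ^ 2) * -s⁻¹‖ = Real.exp (-(1/2) * s ^ 2) := by
        rw [mul_neg, norm_neg, Real.norm_of_nonneg (by positivity)]
        field_simp
      rw [this]
      refine mul_le_mul_of_nonneg_left ?_ (Real.exp_pos _).le
      refine (norm_integral_le_integral_norm _).trans
        (le_trans (le_of_eq ?_) (hB x hx s hs).2)
      congr 1; funext z
      rw [norm_smul, norm_mul, Real.norm_of_nonneg (ga_pos z).le, Real.norm_eq_abs, pow_one,
        mul_comm])
    (((integrable_exp_neg_mul_sq (b := 1/2) (by norm_num)).restrict (s := Set.Ioi 0)).mul_const B)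
    (by
      filter_upwards [ae_restrict_mem measurableSet_Ioi] with s hs x hx
      exact (D1 hg hg2 hs x).const_smul (s * Real.exp (-(1/2) * s ^ 2)))
  rw [hasGradientAt_iff_hasFDerivAt]
  refine key.congr_fderiv ?_
  have e : (InnerProductSpace.toDual ℝ (E N)) (Gf g x₀) = innerSL ℝ (Gf g x₀) := by
    ext u; simp
  rw [e, Gf, map_neg, ← ContinuousLinearMap.integral_comp_comm _ (Gf_int hg hg2 x₀), ← integral_neg]
  refine setIntegral_congr_fun measurableSet_Ioi fun s hs => ?_
  have hs' : (0:ℝ) < s := hs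
  simp only [map_smul, smul_smul]
  rw [← neg_smul]
  congr 1
  field_simp

/-- L² bound (Minkowski) for averages of translates. -/
lemma mink {N : ℕ} {P : Type*} [MeasurableSpace P] (ν : Measure P) [SFinite ν]
    {τ : P → E N} (hτ : Measurable τ) {f : E N → ℝ≥0∞} (hf : Measurable f) :
    ∫⁻ x, (∫⁻ p, f (x - τ p) ∂ν) ^ (2:ℝ) ≤ ν Set.univ ^ (2:ℝ) * ∫⁻ x, f x ^ (2:ℝ) := by
  have hm : Measurable (fun q : E N × P => f (q.1 - τ q.2)) :=
    hf.comp (measurable_fst.sub (hτ.comp measurable_snd))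
  have h1 : ∀ x, (∫⁻ p, f (x - τ p) ∂ν) ^ (2:ℝ) ≤
      ν Set.univ * ∫⁻ p, f (x - τ p) ^ (2:ℝ) ∂ν := by
    intro x
    have hmx : Measurable (fun p => f (x - τ p)) := hm.comp measurable_prodMk_left
    have := ENNReal.lintegral_mul_le_Lp_mul_Lq ν Real.HolderConjugate.two_two
      (f := fun _ => 1) (g := fun p => f (x - τ p)) aemeasurable_const hmx.aemeasurable
    simp only [Pi.mul_apply, one_mul, ENNReal.one_rpow, lintegral_const] at this
    calc _ ≤ _ := ENNReal.rpow_le_rpow this (by norm_num)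
      _ = _ := by
        rw [ENNReal.mul_rpow_of_nonneg _ _ (by norm_num), ← ENNReal.rpow_mul, ← ENNReal.rpow_mul]
        norm_num
  calc _ ≤ ∫⁻ x, ν Set.univ * ∫⁻ p, f (x - τ p) ^ (2:ℝ) ∂ν := lintegral_mono h1
    _ = ν Set.univ * ∫⁻ x, ∫⁻ p, f (x - τ p) ^ (2:ℝ) ∂ν := by
      rw [lintegral_const_mul]
      exact (hm.pow_const 2).lintegral_prod_right
    _ = ν Set.univ * ∫⁻ p, (∫⁻ x, f (x - τ p) ^ (2:ℝ)) ∂ν := by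
      rw [lintegral_lintegral_swap]
      exact (hm.pow_const 2).aemeasurable
    _ = ν Set.univ * ∫⁻ _p, (∫⁻ x, f x ^ (2:ℝ)) ∂ν := by
      congr 2; funext p
      exact lintegral_sub_right_eq_self (fun x => f x ^ (2:ℝ)) (τ p)
    _ = _ := by
      rw [lintegral_const, show (2:ℝ) = ((2:ℕ):ℝ) by norm_num, ENNReal.rpow_natCast]
      ring

lemma memLp_of_kernel {N : ℕ} {F : Type*} [NormedAddCommGroup F] {P : Type*} [MeasurableSpace P]
    (μ : Measure P) [SFinite μ] {τ : P → E N} (hτ : Measurable τ) {κ : P → ℝ} (hκm : Measurable κ)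
    (hκ : Integrable κ μ) {g : E N → ℝ} (hgm : Measurable g) (hg2 : MemLp g 2 volume)
    {u : E N → F} (hu : AEStronglyMeasurable u volume)
    (hb : ∀ x, ‖u x‖ₑ ≤ ∫⁻ p, ‖κ p‖ₑ * ‖g (x - τ p)‖ₑ ∂μ) : MemLp u 2 volume := by
  refine ⟨hu, ?_⟩
  rw [eLpNorm_lt_top_iff_lintegral_rpow_enorm_lt_top (by norm_num) (by norm_num)]
  have hg := hg2.2
  rw [eLpNorm_lt_top_iff_lintegral_rpow_enorm_lt_top (by norm_num) (by norm_num)] at hg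
  simp only [ENNReal.toReal_ofNat] at hg ⊢
  have hmk := mink (μ.withDensity fun p => ‖κ p‖ₑ) hτ (f := fun x => ‖g x‖ₑ) hgm.enorm
  have hfin : (μ.withDensity fun p => ‖κ p‖ₑ) Set.univ < ⊤ := by
    rw [withDensity_apply _ MeasurableSet.univ, Measure.restrict_univ]
    exact hκ.2
  refine lt_of_le_of_lt ((lintegral_mono fun x => ENNReal.rpow_le_rpow ((hb x).trans (le_of_eq ?_))
    (by norm_num)).trans hmk) (ENNReal.mul_lt_top (ENNReal.rpow_lt_top_of_nonneg (by norm_num) hfin.ne) hg)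
  rw [lintegral_withDensity_eq_lintegral_mul _ hκm.enorm]
  · rfl
  · exact hgm.enorm.comp (measurable_const.sub hτ)


lemma shear {N : ℕ} {P : Type*} [MeasurableSpace P] (μ : Measure P) [SFinite μ]
    {τ : P → E N} (hτ : Measurable τ) :
    MeasurePreserving (fun q : P × E N => (q.1, q.2 + τ q.1)) (μ.prod volume) (μ.prod volume) := by
  refine (MeasurePreserving.id μ).skew_product (g := fun p x => x + τ p) ?_ ?_
  · exact measurable_snd.add (hτ.comp measurable_fst)
  · exact ae_of_all _ fun p => (measurePreserving_add_right volume (τ p)).map_eq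

lemma triple_int {N : ℕ} {P : Type*} [MeasurableSpace P] (μ : Measure P) [SFinite μ]
    {τ : P → E N} (hτ : Measurable τ) {κ : P → ℝ} (hκ : Integrable κ μ) (hκm : Measurable κ)
    {f₁ f₂ : E N → ℝ} (h1m : Measurable f₁) (h1 : MemLp f₁ 2 volume)
    (h2m : Measurable f₂) (h2 : MemLp f₂ 2 volume) :
    Integrable (fun q : P × E N => κ q.1 * (f₁ q.2 * f₂ (q.2 + τ q.1))) (μ.prod volume) := by
  have i1 : Integrable (fun q : P × E N => |κ q.1| * f₁ q.2 ^ 2) (μ.prod volume) :=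
    hκ.abs.mul_prod h1.integrable_sq
  have i2 : Integrable (fun q : P × E N => |κ q.1| * f₂ (q.2 + τ q.1) ^ 2) (μ.prod volume) :=
    (shear μ hτ).integrable_comp_of_integrable (hκ.abs.mul_prod h2.integrable_sq)
  refine (i1.add i2).mono' ?_ (ae_of_all _ fun q => ?_)
  · refine Measurable.aestronglyMeasurable ?_
    exact (hκm.comp measurable_fst).mul ((h1m.comp measurable_snd).mul
      (h2m.comp (measurable_snd.add (hτ.comp measurable_fst))))
  · simp only [Pi.add_apply]
    rw [norm_mul, Real.norm_eq_abs, ← mul_add]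
    refine mul_le_mul_of_nonneg_left ?_ (abs_nonneg _)
    rw [Real.norm_eq_abs, abs_le]
    constructor <;> nlinarith [sq_nonneg (f₁ q.2 - f₂ (q.2 + τ q.1)),
      sq_nonneg (f₁ q.2 + f₂ (q.2 + τ q.1)), sq_nonneg (f₁ q.2), sq_nonneg (f₂ (q.2 + τ q.1))]

/-- the parameter measure -/
noncomputable def mP (N : ℕ) : Measure (ℝ × E N) :=
  (volume.restrict (Set.Ioi (0:ℝ))).prod volume

instance (N : ℕ) : SFinite (mP N) := by unfold mP; infer_instance

lemma kint {N : ℕ} (j : ℕ) : Integrable (fun p : ℝ × E N =>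
    Real.exp (-(1/2) * p.1 ^ 2) * (‖p.2‖ ^ j * ga p.2)) (mP N) :=
  ((integrable_exp_neg_mul_sq (b := 1/2) (by norm_num)).restrict
    (s := Set.Ioi 0)).mul_prod (gauss_int j)

lemma kint1 {N : ℕ} (j : ℕ) : Integrable (fun p : ℝ × E N =>
    (p.1 * Real.exp (-(1/2) * p.1 ^ 2)) * (‖p.2‖ ^ j * ga p.2)) (mP N) :=
  ((integrable_mul_exp_neg_mul_sq (b := 1/2) (by norm_num)).restrict
    (s := Set.Ioi 0)).mul_prod (gauss_int j)

lemma tau_cont {N : ℕ} : Continuous (fun p : ℝ × E N => p.1 • p.2) := by fun_prop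

lemma grad_meas {N : ℕ} (u : E N → ℝ) : Measurable (fun x => gradient u x) := by
  have : (fun x => gradient u x) = fun x => (InnerProductSpace.toDual ℝ (E N)).symm (fderiv ℝ u x) := rfl
  rw [this]
  exact (LinearIsometryEquiv.continuous _).measurable.comp (measurable_fderiv ℝ u)

lemma wf_memH1 {N : ℕ} {g : E N → ℝ} (hg : Continuous g) (hg2 : MemLp g 2 volume) :
    MemH1 N (wf g) := by
  have hd : Differentiable ℝ (wf g) := fun x => (D2 hg hg2 x).differentiableAt
  have hgc := @ga_cont N
  refine ⟨hd, ?_, ?_⟩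
  · refine memLp_of_kernel (mP N) tau_cont.measurable
      (κ := fun p => (p.1 * Real.exp (-(1/2) * p.1 ^ 2)) * (‖p.2‖ ^ 0 * ga p.2))
      (Continuous.measurable (by fun_prop)) (kint1 0) hg.measurable hg2
      hd.continuous.aestronglyMeasurable (fun x => ?_)
    refine (enorm_integral_le_lintegral_enorm _).trans ?_
    rw [mP, lintegral_prod]
    swap
    · refine Measurable.aemeasurable (Measurable.fun_mul ?_ ?_)
      · exact Measurable.enorm (Continuous.measurable (by fun_prop))
      · exact Measurable.enorm (Continuous.measurable (by fun_prop))
    refine lintegral_mono fun s => ?_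
    rw [enorm_mul]
    refine (mul_le_mul_right (enorm_integral_le_lintegral_enorm _) _).trans ?_
    rw [← lintegral_const_mul _ (Continuous.measurable (by fun_prop))]
    refine lintegral_mono fun z => le_of_eq ?_
    simp only [enorm_mul, pow_zero, one_mul]
    ring
  · refine memLp_of_kernel (mP N) tau_cont.measurable
      (κ := fun p => Real.exp (-(1/2) * p.1 ^ 2) * (‖p.2‖ ^ 1 * ga p.2))
      (Continuous.measurable (by fun_prop)) (kint 1) hg.measurable hg2
      (grad_meas _).aestronglyMeasurable (fun x => ?_)
    rw [(D2 hg hg2 x).gradient, Gf, enorm_neg]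
    refine (enorm_integral_le_lintegral_enorm _).trans ?_
    rw [mP, lintegral_prod]
    swap
    · refine Measurable.aemeasurable (Measurable.fun_mul ?_ ?_)
      · exact Measurable.enorm (Continuous.measurable (by fun_prop))
      · exact Measurable.enorm (Continuous.measurable (by fun_prop))
    refine lintegral_mono fun s => ?_
    rw [enorm_smul]
    refine (mul_le_mul_right (enorm_integral_le_lintegral_enorm _) _).trans ?_
    rw [← lintegral_const_mul _ (Continuous.measurable (by fun_prop))]
    refine lintegral_mono fun z => le_of_eq ?_
    simp only [enorm_mul, pow_one, enorm_smul, enorm_norm]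
    ring

lemma ibp_s {N : ℕ} {h : E N → ℝ} (hh : Differentiable ℝ h) (x z : E N)
    (i1 : IntegrableOn (fun s : ℝ => Real.exp (-(1/2) * s ^ 2) * ⟪gradient h (x + s • z), z⟫
      - s * Real.exp (-(1/2) * s ^ 2) * h (x + s • z)) (Set.Ioi 0))
    (i2 : IntegrableOn (fun s : ℝ => Real.exp (-(1/2) * s ^ 2) * h (x + s • z)) (Set.Ioi 0)) :
    ∫ s in Set.Ioi (0:ℝ), (Real.exp (-(1/2) * s ^ 2) * ⟪gradient h (x + s • z), z⟫
      - s * Real.exp (-(1/2) * s ^ 2) * h (x + s • z)) = - h x := by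
  have hd : ∀ s : ℝ, HasDerivAt (fun s : ℝ => Real.exp (-(1/2) * s ^ 2) * h (x + s • z))
      (Real.exp (-(1/2) * s ^ 2) * ⟪gradient h (x + s • z), z⟫
      - s * Real.exp (-(1/2) * s ^ 2) * h (x + s • z)) s := by
    intro s
    have a1 : HasDerivAt (fun s : ℝ => x + s • z) z s := by
      simpa using ((hasDerivAt_id s).smul_const z).const_add x
    have a2 : HasDerivAt (fun s : ℝ => h (x + s • z)) (fderiv ℝ h (x + s • z) z) s :=
      (hh (x + s • z)).hasFDerivAt.comp_hasDerivAt s a1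
    have a3 : HasDerivAt (fun s : ℝ => Real.exp (-(1/2) * s ^ 2))
        (Real.exp (-(1/2) * s ^ 2) * (-(1/2) * (2 * s))) s := by
      have := ((hasDerivAt_pow 2 s).const_mul (-(1/2) : ℝ)).exp
      simpa using this
    refine (a3.mul a2).congr_deriv ?_
    rw [inner_gradient_left]; ring
  have ht := tendsto_zero_of_hasDerivAt_of_integrableOn_Ioi (fun s _ => hd s) i1 i2
  rw [integral_Ioi_of_hasDerivAt_of_tendsto' (fun s _ => hd s) i1 ht]
  simp

lemma inner_s {N : ℕ} {g h : E N → ℝ} (hh : Differentiable ℝ h) (x z : E N)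
    (i1 : IntegrableOn (fun s : ℝ => (s * Real.exp (-(1/2) * s ^ 2)) * ga z * (g x * h (x + s • z))
      - Real.exp (-(1/2) * s ^ 2) * ga z * (g x * ⟪gradient h (x + s • z), z⟫)) (Set.Ioi 0))
    (i2 : IntegrableOn (fun s : ℝ => Real.exp (-(1/2) * s ^ 2) * ga z * (g x * h (x + s • z)))
      (Set.Ioi 0)) :
    ∫ s in Set.Ioi (0:ℝ), ((s * Real.exp (-(1/2) * s ^ 2)) * ga z * (g x * h (x + s • z))
      - Real.exp (-(1/2) * s ^ 2) * ga z * (g x * ⟪gradient h (x + s • z), z⟫))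
      = ga z * (h x * g x) := by
  by_cases h0 : g x = 0
  · simp [h0]
  have hz := (ga_pos z).ne'
  have e1 : ∀ s : ℝ, ((s * Real.exp (-(1/2) * s ^ 2)) * ga z * (g x * h (x + s • z))
      - Real.exp (-(1/2) * s ^ 2) * ga z * (g x * ⟪gradient h (x + s • z), z⟫))
      = (-(ga z * g x)) * (Real.exp (-(1/2) * s ^ 2) * ⟪gradient h (x + s • z), z⟫
      - s * Real.exp (-(1/2) * s ^ 2) * h (x + s • z)) := fun s => by ring
  have e2 : ∀ s : ℝ, Real.exp (-(1/2) * s ^ 2) * ga z * (g x * h (x + s • z))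
      = (ga z * g x) * (Real.exp (-(1/2) * s ^ 2) * h (x + s • z)) := fun s => by ring
  simp only [e1] at i1 ⊢
  simp only [e2] at i2
  have hne : ga z * g x ≠ 0 := mul_ne_zero hz h0
  have j1 := (integrable_const_mul_iff (neg_ne_zero.2 hne).isUnit _).1 i1
  have j2 := (integrable_const_mul_iff hne.isUnit _).1 i2
  rw [integral_const_mul, ibp_s hh x z j1 j2]
  ring

lemma ident {N : ℕ} {g h : E N → ℝ} (hg : Continuous g) (hg2 : MemLp g 2 volume)
    (hh : MemH1 N h) :
    ∫ x, (⟪gradient h x, gradient (wf g) x⟫ + h x * wf g x)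
      = (∫ z : E N, ga z) * ∫ x, h x * g x := by
  obtain ⟨hd, hh2, hG2⟩ := hh
  have hgc := @ga_cont N
  have hτ := (@tau_cont N).measurable
  have hGm := grad_meas h
  have hhm := hd.continuous.measurable
  let F1 : (ℝ × E N) × E N → ℝ := fun q => (q.1.1 * Real.exp (-(1/2) * q.1.1 ^ 2)) * ga q.1.2 *
    (g q.2 * h (q.2 + q.1.1 • q.1.2))
  let F2 : (ℝ × E N) × E N → ℝ := fun q => Real.exp (-(1/2) * q.1.1 ^ 2) * ga q.1.2 *
    (g q.2 * ⟪gradient h (q.2 + q.1.1 • q.1.2), q.1.2⟫)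
  let F3 : (ℝ × E N) × E N → ℝ := fun q => Real.exp (-(1/2) * q.1.1 ^ 2) * ga q.1.2 *
    (g q.2 * h (q.2 + q.1.1 • q.1.2))
  have I1 : Integrable F1 ((mP N).prod volume) := by
    have := triple_int (mP N) hτ (kint1 0) (Continuous.measurable (by fun_prop))
      hg.measurable hg2 hhm hh2
    simpa only [pow_zero, one_mul] using this
  have I3 : Integrable F3 ((mP N).prod volume) := by
    have := triple_int (mP N) hτ (kint 0) (Continuous.measurable (by fun_prop))
      hg.measurable hg2 hhm hh2
    simpa only [pow_zero, one_mul] using this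
  have I2 : Integrable F2 ((mP N).prod volume) := by
    have := triple_int (mP N) hτ (kint 1) (Continuous.measurable (by fun_prop))
      hg.measurable.norm hg2.norm hGm.norm hG2.norm
    refine this.mono' ?_ (ae_of_all _ fun q => ?_)
    · refine Measurable.aestronglyMeasurable ?_
      have m1 : Measurable fun q : (ℝ × E N) × E N => Real.exp (-(1/2) * q.1.1 ^ 2) * ga q.1.2 :=
        Continuous.measurable (by fun_prop)
      have m2 : Measurable fun q : (ℝ × E N) × E N => gradient h (q.2 + q.1.1 • q.1.2) :=
        hGm.comp (Continuous.measurable (by fun_prop))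
      have m3 : Measurable fun q : (ℝ × E N) × E N => q.1.2 :=
        Continuous.measurable (by fun_prop)
      exact m1.mul ((hg.measurable.comp measurable_snd).mul (m2.inner m3))
    · simp only [F2, norm_mul, Real.norm_eq_abs, abs_of_pos (ga_pos _), Real.abs_exp, pow_one]
      have c1 := abs_real_inner_le_norm (gradient h (q.2 + q.1.1 • q.1.2)) q.1.2
      have c2 : 0 ≤ Real.exp (-(1/2) * q.1.1 ^ 2) * ga q.1.2 * |g q.2| := by
        have := ga_pos q.1.2
        positivity
      nlinarith [mul_le_mul_of_nonneg_left c1 c2]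
  have I12 : Integrable (fun q => F1 q - F2 q) ((mP N).prod volume) := I1.sub I2
  -- the sheared version
  have hS := shear (mP N) (τ := fun p : ℝ × E N => -(p.1 • p.2)) hτ.neg
  have J1 := hS.integrable_comp_of_integrable I1
  have J2 := hS.integrable_comp_of_integrable I2
  have J12 := hS.integrable_comp_of_integrable I12
  have step1 : ∫ q, (F1 q - F2 q) ∂((mP N).prod volume) =
      ∫ x, ∫ p, ((fun q => F1 q - F2 q) ∘
        (fun q : (ℝ × E N) × E N => (q.1, q.2 + -(q.1.1 • q.1.2)))) (p, x) ∂(mP N) := by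
    rw [← integral_prod_symm _ J12]
    conv_lhs => rw [← hS.map_eq]
    rw [integral_map hS.measurable.aemeasurable]
    · rfl
    · rw [hS.map_eq]; exact I12.aestronglyMeasurable
  have step2 : ∫ x, (⟪gradient h x, gradient (wf g) x⟫ + h x * wf g x) =
      ∫ q, (F1 q - F2 q) ∂((mP N).prod volume) := by
    rw [step1]
    refine integral_congr_ae ?_
    filter_upwards [J1.prod_left_ae, J2.prod_left_ae] with x a1 a2
    have e3 := integral_sub a1 a2
    simp only [Function.comp_def] at e3 a1 a2 ⊢
    rw [e3]
    unfold mP at a1 a2 ⊢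
    rw [integral_prod _ a1, integral_prod _ a2, (D2 hg hg2 x).gradient]
    have t1 : h x * wf g x = ∫ s in Set.Ioi (0:ℝ), ∫ z : E N,
        F1 ((s, z), x + -(s • z)) := by
      rw [wf, ← integral_const_mul]
      refine integral_congr_ae (ae_of_all _ fun s => ?_)
      simp only
      rw [← integral_const_mul, ← integral_const_mul]
      refine integral_congr_ae (ae_of_all _ fun z => ?_)
      simp only [F1, ← sub_eq_add_neg]
      simp only [sub_add_cancel]
      ring
    have t2 : ⟪gradient h x, Gf g x⟫ = -∫ s in Set.Ioi (0:ℝ), ∫ z : E N,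
        F2 ((s, z), x + -(s • z)) := by
      rw [Gf, inner_neg_right, ← integral_inner (Gf_int hg hg2 x)]
      congr 1
      refine setIntegral_congr_fun measurableSet_Ioi fun s hs => ?_
      rw [inner_smul_right, ← integral_inner (Gf_int_inner hg hg2 x hs), ← integral_const_mul]
      refine integral_congr_ae (ae_of_all _ fun z => ?_)
      simp only [F2, ← sub_eq_add_neg, sub_add_cancel, inner_smul_right]
      ring
    rw [t1, t2]
    ring
  rw [step2]
  have hA := measurePreserving_prodAssoc (volume.restrict (Set.Ioi (0:ℝ)))
    (volume : Measure (E N)) (volume : Measure (E N))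
  have hA' := hA.symm
  have K12 := hA'.integrable_comp_of_integrable (g := fun q => F1 q - F2 q) I12
  have K3 := hA'.integrable_comp_of_integrable (g := F3) I3
  have step3 : ∫ q, (F1 q - F2 q) ∂((mP N).prod volume) =
      ∫ r, ((fun q => F1 q - F2 q) ∘ MeasurableEquiv.prodAssoc.symm) r
        ∂((volume.restrict (Set.Ioi (0:ℝ))).prod (volume.prod volume)) :=
    (hA'.integral_comp' (fun q => F1 q - F2 q)).symm
  rw [step3, integral_prod_symm _ K12, ← integral_prod_mul]
  refine integral_congr_ae ?_
  filter_upwards [K12.prod_left_ae, K3.prod_left_ae] with y b1 b2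
  exact inner_s hd y.2 y.1 b1 b2

/-- the radial cutoff -/
noncomputable def psi {N : ℕ} (R : ℕ) (x : E N) : ℝ := max 0 (min (‖x‖ - R) 1)

lemma psi_cont {N : ℕ} (R : ℕ) : Continuous (psi R : E N → ℝ) := by unfold psi; fun_prop

lemma psi_nonneg {N : ℕ} (R : ℕ) (x : E N) : 0 ≤ psi R x := le_max_left _ _

lemma psi_le_one {N : ℕ} (R : ℕ) (x : E N) : psi R x ≤ 1 :=
  max_le zero_le_one (min_le_right _ _)

lemma psi_zero {N : ℕ} {R : ℕ} {x : E N} (h : ‖x‖ ≤ R) : psi R x = 0 := by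
  unfold psi
  exact max_eq_left ((min_le_left _ _).trans (by linarith))

lemma psi_one {N : ℕ} {R : ℕ} {x : E N} (h : R + 1 ≤ ‖x‖) : psi R x = 1 := by
  unfold psi
  rw [min_eq_right (by linarith)]
  exact max_eq_right zero_le_one

lemma weight {N : ℕ} {f : E N → ℝ} (hf : Continuous f) (hf2 : MemLp f 2 volume) :
    ∃ W : E N → ℝ, Continuous W ∧ (∀ x, 1 ≤ W x) ∧ Tendsto W (cocompact (E N)) atTop ∧
      Integrable (fun x => f x ^ 2 * W x) := by
  have hsq := hf2.integrable_sq
  have ht : Tendsto (fun m : ℕ => ∫ x, f x ^ 2 * psi m x) atTop (𝓝 0) := by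
    have := tendsto_integral_of_dominated_convergence (μ := (volume : Measure (E N)))
      (F := fun (m : ℕ) x => f x ^ 2 * psi m x) (f := fun _ => (0:ℝ)) (fun x => f x ^ 2)
      (fun m => ((hf.pow 2).mul (psi_cont m)).aestronglyMeasurable) hsq
      (fun m => ae_of_all _ fun x => by
        rw [Real.norm_of_nonneg (mul_nonneg (sq_nonneg _) (psi_nonneg _ _))]
        exact mul_le_of_le_one_right (sq_nonneg _) (psi_le_one _ _))
      (ae_of_all _ fun x => by
        refine tendsto_const_nhds.congr' ?_
        filter_upwards [eventually_ge_atTop ⌈‖x‖⌉₊] with m hm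
        rw [psi_zero ((Nat.le_ceil _).trans (by exact_mod_cast hm)), mul_zero])
    simpa using this
  have hex : ∀ n : ℕ, ∃ R : ℕ, n ≤ R ∧ ∫ x, f x ^ 2 * psi R x ≤ (1/2 : ℝ) ^ n := by
    intro n
    have := (ht.eventually_le_const (u := (1/2 : ℝ) ^ n) (by positivity)).and (eventually_ge_atTop n)
    obtain ⟨R, h1, h2⟩ := this.exists
    exact ⟨R, h2, h1⟩
  choose R hR hRi using hex
  have hz : ∀ (M : ℕ) (x : E N), ‖x‖ ≤ M → ∀ n ∉ Finset.range M, psi (R n) x = 0 := by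
    intro M x hx n hn
    refine psi_zero (hx.trans ?_)
    have := hR n
    simp only [Finset.mem_range, not_lt] at hn
    exact_mod_cast hn.trans this
  have hsum : ∀ x : E N, Summable fun n => psi (R n) x := fun x =>
    summable_of_ne_finset_zero (hz ⌈‖x‖⌉₊ x (Nat.le_ceil _))
  refine ⟨fun x => 1 + ∑' n, psi (R n) x, ?_, ?_, ?_, ?_⟩
  · refine continuous_const.add (continuous_iff_continuousAt.2 fun x => ?_)
    have : ContinuousAt (fun y : E N => ∑ n ∈ Finset.range ⌈‖x‖ + 1⌉₊, psi (R n) y) x :=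
      (continuous_finsetSum _ fun n _ => psi_cont (R n)).continuousAt
    refine this.congr ?_
    filter_upwards [(continuous_norm.tendsto x).eventually_le_const (u := ‖x‖ + 1) (by linarith)]
      with y hy
    exact (tsum_eq_sum (hz _ y (hy.trans (Nat.le_ceil _)))).symm
  · intro x
    have : 0 ≤ ∑' n, psi (R n) x := tsum_nonneg (fun n => psi_nonneg _ _)
    linarith
  · rw [tendsto_atTop]
    intro b
    obtain ⟨m, hm⟩ := exists_nat_ge b
    have h1 : ∀ᶠ x : E N in cocompact (E N), ∀ n ∈ Finset.range m, ((R n : ℝ) + 1) ≤ ‖x‖ := by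
      rw [Filter.eventually_all_finset]
      exact fun n _ => (tendsto_norm_cocompact_atTop (E := E N)).eventually_ge_atTop _
    filter_upwards [h1] with x hx
    have h2 := (hsum x).sum_le_tsum (Finset.range m) (fun n _ => psi_nonneg _ _)
    rw [Finset.sum_congr rfl (fun n hn => psi_one (hx n hn))] at h2
    simp at h2
    linarith
  · have i1 : ∀ n, Integrable fun x => f x ^ 2 * psi (R n) x := fun n =>
      hsq.mono' ((hf.pow 2).mul (psi_cont _)).aestronglyMeasurable (ae_of_all _ fun x => by
        rw [Real.norm_of_nonneg (mul_nonneg (sq_nonneg _) (psi_nonneg _ _))]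
        exact mul_le_of_le_one_right (sq_nonneg _) (psi_le_one _ _))
    have i2 : Integrable fun x => ∑' n, f x ^ 2 * psi (R n) x := by
      refine ⟨?_, ?_⟩
      · have : Measurable fun x => ∑' n, f x ^ 2 * psi (R n) x :=
          Measurable.tsum fun n => ((hf.pow 2).mul (psi_cont _)).measurable
        exact this.aestronglyMeasurable
      · refine lt_of_le_of_lt (lintegral_mono fun x => enorm_tsum_le_tsum_enorm) ?_
        rw [lintegral_tsum fun n => (i1 n).aestronglyMeasurable.enorm]
        have : ∀ n, ∫⁻ x, ‖f x ^ 2 * psi (R n) x‖ₑ ≤ ENNReal.ofReal ((1/2) ^ n) := by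
          intro n
          rw [← ofReal_integral_norm_eq_lintegral_enorm (i1 n)]
          refine ENNReal.ofReal_le_ofReal (le_trans (le_of_eq ?_) (hRi n))
          refine integral_congr_ae (ae_of_all _ fun x => ?_)
          exact Real.norm_of_nonneg (mul_nonneg (sq_nonneg _) (psi_nonneg _ _))
        refine lt_of_le_of_lt (ENNReal.tsum_le_tsum this) ?_
        exact (summable_geometric_two).tsum_ofReal_lt_top
    have i3 := hsq.add i2
    refine i3.congr (ae_of_all _ fun x => ?_)
    simp only [Pi.add_apply]
    rw [tsum_mul_left]; ring

lemma ga_int_pos {N : ℕ} : 0 < ∫ z : E N, ga z := by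
  have h0 : Integrable (fun z : E N => ga z) := by simpa using gauss_int (N := N) 0
  rw [integral_pos_iff_support_of_nonneg (fun z => (ga_pos z).le) h0]
  have : Function.support (fun z : E N => ga z) = Set.univ := by
    ext z; simp [(ga_pos z).ne']
  rw [this]
  exact Measure.measure_univ_pos.2 (NeZero.ne _)

lemma pair_tendsto {N : ℕ} {h : ℕ → E N → ℝ} (hh : ∀ k, MemH1 N (h k))
    (hw : ∀ w, MemH1 N w → Tendsto (fun k => ∫ x, (⟪gradient (h k) x, gradient w x⟫ + h k x * w x))
      atTop (𝓝 0)) {g : E N → ℝ} (hg : Continuous g) (hg2 : MemLp g 2 volume) :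
    Tendsto (fun k => ∫ x, h k x * g x) atTop (𝓝 0) := by
  have h1 := hw (wf g) (wf_memH1 hg hg2)
  simp only [ident hg hg2 (hh _)] at h1
  have h2 := h1.const_mul (∫ z : E N, ga z)⁻¹
  simpa [← mul_assoc, inv_mul_cancel₀ (ga_int_pos (N := N)).ne'] using h2

open BoundedContinuousFunction in
lemma unif_bound {N : ℕ} {h : ℕ → E N → ℝ} (hh : ∀ k, MemH1 N (h k))
    (hw : ∀ w, MemH1 N w → Tendsto (fun k => ∫ x, (⟪gradient (h k) x, gradient w x⟫ + h k x * w x))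
      atTop (𝓝 0)) {g : E N → ℝ} (hg : Continuous g) (hg2 : MemLp g 2 volume) :
    ∃ C : ℝ, ∀ (k : ℕ) (a : E N →ᵇ ℝ), |∫ x, a x * (h k x * g x)| ≤ C * ‖a‖ := by
  have hi : ∀ k, Integrable fun x => h k x * g x := fun k => (hh k).2.1.integrable_mul hg2
  have hia : ∀ k (a : E N →ᵇ ℝ), Integrable fun x => a x * (h k x * g x) := fun k a =>
    (hi k).bdd_mul a.continuous.aestronglyMeasurable (ae_of_all _ a.norm_coe_le_norm)
  let L : ℕ → (E N →ᵇ ℝ) →L[ℝ] ℝ := fun k => LinearMap.mkContinuous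
    { toFun := fun a => ∫ x, a x * (h k x * g x)
      map_add' := fun a b => by
        rw [← integral_add (hia k a) (hia k b)]
        refine integral_congr_ae (ae_of_all _ fun x => ?_)
        simp [add_mul]
      map_smul' := fun c a => by
        simp only [RingHom.id_apply, smul_eq_mul]
        rw [← integral_const_mul]
        refine integral_congr_ae (ae_of_all _ fun x => ?_)
        simp [mul_assoc] } (∫ x, ‖h k x * g x‖) (fun a => by
      simp only [LinearMap.coe_mk, AddHom.coe_mk]
      rw [mul_comm, ← integral_const_mul]
      refine norm_integral_le_of_norm_le ((hi k).norm.const_mul _) (ae_of_all _ fun x => ?_)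
      rw [norm_mul]
      exact mul_le_mul_of_nonneg_right (a.norm_coe_le_norm x) (norm_nonneg _))
  obtain ⟨C, hC⟩ := banach_steinhaus (g := L) (fun a => by
    have hag : MemLp (fun x => a x * g x) 2 volume :=
      (hg2.const_mul ‖a‖).mono (a.continuous.mul hg).aestronglyMeasurable (ae_of_all _ fun x => by
        rw [norm_mul, norm_mul, norm_norm]
        exact mul_le_mul_of_nonneg_right (a.norm_coe_le_norm x) (norm_nonneg _))
    have ht := pair_tendsto hh hw (a.continuous.mul hg) hag
    obtain ⟨C, hC⟩ := (ht.norm).bddAbove_range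
    refine ⟨C, fun k => ?_⟩
    have := hC ⟨k, rfl⟩
    refine le_trans (le_of_eq ?_) this
    change ‖∫ x, a x * (h k x * g x)‖ = _
    congr 2
    funext x
    simp only [Pi.mul_apply]
    ring)
  refine ⟨C, fun k a => ?_⟩
  exact ((L k).le_opNorm a).trans (mul_le_mul_of_nonneg_right (hC k) (norm_nonneg _))

lemma V_bdd {N : ℕ} {V : E N → ℝ} {Vinf : ℝ} (hV : Continuous V)
    (hl : Tendsto V (cocompact (E N)) (𝓝 Vinf)) : ∃ B, 0 ≤ B ∧ ∀ x, |V x - Vinf| ≤ B := by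
  have h1 : ∀ᶠ x in cocompact (E N), |V x - Vinf| ≤ 1 := by
    have := (hl.sub_const Vinf).abs
    simp only [sub_self, abs_zero] at this
    exact this.eventually_le_const one_pos
  rw [Filter.Eventually, mem_cocompact] at h1
  obtain ⟨K, hK, hKs⟩ := h1
  obtain ⟨M, hM⟩ := hK.exists_bound_of_continuousOn (hV.sub continuous_const).continuousOn
    (f := fun x => V x - Vinf)
  refine ⟨max 1 M, le_max_of_le_left zero_le_one, fun x => ?_⟩
  by_cases hx : x ∈ K
  · exact (hM x hx).trans (le_max_right _ _)
  · exact (hKs hx).trans (le_max_left _ _)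

lemma unif_small {N : ℕ} {V : E N → ℝ} {Vinf : ℝ} (hV : Continuous V)
    (hl : Tendsto V (cocompact (E N)) (𝓝 Vinf)) {W : E N → ℝ} (hW1 : ∀ x, 1 ≤ W x)
    (hW : Tendsto W (cocompact (E N)) atTop)
    {ξ : ℕ → E N} (hξ : Tendsto (fun k => ‖ξ k‖) atTop atTop) {ε : ℝ} (hε : 0 < ε) :
    ∀ᶠ k in atTop, ∀ x, |(V (x + ξ k) - Vinf) * (√(W x))⁻¹| ≤ ε := by
  obtain ⟨B, hB0, hB⟩ := V_bdd hV hl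
  have hη : Tendsto (fun x => (√(W x))⁻¹) (cocompact (E N)) (𝓝 0) :=
    (Real.tendsto_sqrt_atTop.comp hW).inv_tendsto_atTop
  have h1 : ∀ᶠ x in cocompact (E N), (√(W x))⁻¹ ≤ ε / (B + 1) :=
    hη.eventually_le_const (by positivity)
  have h2 : ∀ᶠ x in cocompact (E N), |V x - Vinf| ≤ ε := by
    have := (hl.sub_const Vinf).abs
    simp only [sub_self, abs_zero] at this
    exact this.eventually_le_const hε
  rw [← Metric.cobounded_eq_cocompact] at h1 h2
  obtain ⟨R, -, hR⟩ := hasBasis_cobounded_norm.eventually_iff.1 h1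
  obtain ⟨R', -, hR'⟩ := hasBasis_cobounded_norm.eventually_iff.1 h2
  filter_upwards [hξ.eventually_ge_atTop (R + R')] with k hk x
  have hs1 : 1 ≤ √(W x) := Real.one_le_sqrt.2 (hW1 x)
  have hn : 0 ≤ (√(W x))⁻¹ := by positivity
  have hle : (√(W x))⁻¹ ≤ 1 := inv_le_one_of_one_le₀ hs1
  rw [abs_mul, abs_of_nonneg hn]
  by_cases hx : R ≤ ‖x‖
  · calc |V (x + ξ k) - Vinf| * (√(W x))⁻¹ ≤ (B + 1) * (ε / (B + 1)) :=
        mul_le_mul ((hB _).trans (by linarith)) (hR hx) hn (by linarith)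
      _ = ε := by field_simp
  · have : R' ≤ ‖x + ξ k‖ := by
      have := norm_sub_le (x + ξ k) x
      rw [add_sub_cancel_left] at this
      push Not at hx
      linarith
    calc |V (x + ξ k) - Vinf| * (√(W x))⁻¹ ≤ ε * 1 :=
        mul_le_mul (hR' this) hle hn hε.le
      _ = ε := mul_one _

lemma tail_zero {N : ℕ} {V : E N → ℝ} {Vinf : ℝ} (hV : Continuous V)
    (hl : Tendsto V (cocompact (E N)) (𝓝 Vinf))
    {ξ : ℕ → E N} (hξ : Tendsto (fun k => ‖ξ k‖) atTop atTop)
    {h : ℕ → E N → ℝ} (hh : ∀ k, MemH1 N (h k))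
    (hw : ∀ w, MemH1 N w → Tendsto (fun k => ∫ x, (⟪gradient (h k) x, gradient w x⟫ + h k x * w x))
      atTop (𝓝 0)) {f : E N → ℝ} (hf : Continuous f) (hf2 : MemLp f 2 volume) :
    Tendsto (fun k => ∫ x, (V (x + ξ k) - Vinf) * (h k x * f x)) atTop (𝓝 0) := by
  obtain ⟨W, hWc, hW1, hWt, hWi⟩ := weight hf hf2
  have hsc : Continuous fun x => √(W x) := hWc.sqrt
  have hs1 : ∀ x, 1 ≤ √(W x) := fun x => Real.one_le_sqrt.2 (hW1 x)
  have hg : Continuous fun x => f x * √(W x) := hf.mul hsc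
  have hg2 : MemLp (fun x => f x * √(W x)) 2 volume := by
    rw [memLp_two_iff_integrable_sq hg.aestronglyMeasurable]
    refine hWi.congr (ae_of_all _ fun x => ?_)
    simp only
    rw [mul_pow, Real.sq_sqrt (zero_le_one.trans (hW1 x))]
  obtain ⟨C, hC⟩ := unif_bound hh hw hg hg2
  obtain ⟨B, hB0, hB⟩ := V_bdd hV hl
  rw [Metric.tendsto_atTop']
  intro ε hε
  have hδ : 0 < ε / (2 * (|C| + 1)) := by positivity
  have hev := unif_small hV hl hW1 hWt hξ hδ
  obtain ⟨k0, hk0⟩ := eventually_atTop.1 hev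
  refine ⟨k0, fun k hk => ?_⟩
  have hb := hk0 k hk.le
  let a : BoundedContinuousFunction (E N) ℝ := BoundedContinuousFunction.ofNormedAddCommGroup
    (fun x => (V (x + ξ k) - Vinf) * (√(W x))⁻¹)
    (((hV.comp (continuous_id.add continuous_const)).sub continuous_const).mul
      (hsc.inv₀ fun x => (zero_lt_one.trans_le (hs1 x)).ne')) _ hb
  have ha : ‖a‖ ≤ ε / (2 * (|C| + 1)) :=
    BoundedContinuousFunction.norm_ofNormedAddCommGroup_le _ hδ.le hb
  have e : ∫ x, (V (x + ξ k) - Vinf) * (h k x * f x) = ∫ x, a x * (h k x * (f x * √(W x))) := by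
    refine integral_congr_ae (ae_of_all _ fun x => ?_)
    have := (zero_lt_one.trans_le (hs1 x)).ne'
    simp only [a, BoundedContinuousFunction.coe_ofNormedAddCommGroup]
    field_simp
  rw [dist_zero_right, e, Real.norm_eq_abs]
  calc _ ≤ C * ‖a‖ := hC k a
    _ ≤ (|C| + 1) * (ε / (2 * (|C| + 1))) :=
      mul_le_mul ((le_abs_self C).trans (by linarith)) ha (norm_nonneg _) (by positivity)
    _ = ε / 2 := by field_simp
    _ < ε := by linarith

lemma grad_sub {N : ℕ} {u v : E N → ℝ} (hu : Differentiable ℝ u) (hv : Differentiable ℝ v)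
    (x : E N) : gradient (fun y => u y - v y) x = gradient u x - gradient v x := by
  unfold gradient
  rw [fderiv_fun_sub (hu x) (hv x), map_sub]

lemma memH1_sub {N : ℕ} {u v : E N → ℝ} (hu : MemH1 N u) (hv : MemH1 N v) :
    MemH1 N (fun y => u y - v y) := by
  refine ⟨hu.1.sub hv.1, hu.2.1.sub hv.2.1, ?_⟩
  simp only [grad_sub hu.1 hv.1]
  exact hu.2.2.sub hv.2.2

lemma pair_int {N : ℕ} {u v : E N → ℝ} (hu : MemH1 N u) (hv : MemH1 N v) :
    Integrable fun x => ⟪gradient u x, gradient v x⟫ + u x * v x := by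
  refine Integrable.add ?_ (hu.2.1.integrable_mul hv.2.1)
  have h1 : Integrable fun x => ‖gradient u x‖ * ‖gradient v x‖ :=
    hu.2.2.norm.integrable_mul hv.2.2.norm
  refine h1.mono' ((grad_meas u).inner (grad_meas v)).aestronglyMeasurable
    (ae_of_all _ fun x => ?_)
  exact norm_inner_le_norm _ _

lemma norm_int {N : ℕ} {V : E N → ℝ} {Vinf B : ℝ} (hV : Continuous V)
    (hB : ∀ x, |V x - Vinf| ≤ B) {u : E N → ℝ} (hu : MemH1 N u) (ξ : E N) :
    Integrable fun x => ‖gradient u x‖ ^ 2 + V (x + ξ) * u x ^ 2 := by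
  refine (hu.2.2.norm.integrable_sq).add ?_
  refine hu.2.1.integrable_sq.bdd_mul (c := |Vinf| + B)
    (hV.comp (continuous_id.add continuous_const)).aestronglyMeasurable (ae_of_all _ fun x => ?_)
  have h1 := hB (x + ξ)
  have h2 := abs_add_le (V (x + ξ) - Vinf) Vinf
  rw [sub_add_cancel] at h2
  change |V (x + ξ)| ≤ _
  linarith

/-- **Lemma A.1** (Brezis–Lieb type splitting for the translated potentials). -/
theorem statement18 (N : ℕ) (hN : 1 ≤ N)
    (V : E N → ℝ) (Vinf : ℝ) (hVcont : Continuous V) (hV2 : HypV2 N V Vinf)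
    (v : ℕ → E N → ℝ) (vlim : E N → ℝ)
    (hv : ∀ k, MemH1 N (v k)) (hvlim : MemH1 N vlim)
    (hweak : ∀ w : E N → ℝ, MemH1 N w →
      Filter.Tendsto (fun k => ∫ x, (⟪gradient (v k) x, gradient w x⟫ + v k x * w x))
        Filter.atTop (nhds (∫ x, (⟪gradient vlim x, gradient w x⟫ + vlim x * w x))))
    (ξ : ℕ → E N) (hξ : Filter.Tendsto (fun k => ‖ξ k‖) Filter.atTop Filter.atTop) :
    Filter.Tendsto (fun k =>
        normVSq N (fun x => V (x + ξ k)) (v k) -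
          normVSq N (fun x => V (x + ξ k)) (fun x => v k x - vlim x))
      Filter.atTop (nhds (normVSq N (fun _ => Vinf) vlim)) := by
  obtain ⟨-, -, hl⟩ := hV2
  obtain ⟨B, hB0, hB⟩ := V_bdd hVcont hl
  have hh : ∀ k, MemH1 N (fun x => v k x - vlim x) := fun k => memH1_sub (hv k) hvlim
  have hgs := fun k x => grad_sub (hv k).1 hvlim.1 x
  have hw : ∀ w, MemH1 N w → Tendsto (fun k => ∫ x,
      (⟪gradient (fun y => v k y - vlim y) x, gradient w x⟫ + (v k x - vlim x) * w x))
      atTop (𝓝 0) := by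
    intro w hw
    have h1 := (hweak w hw).sub_const (∫ x, (⟪gradient vlim x, gradient w x⟫ + vlim x * w x))
    rw [sub_self] at h1
    refine h1.congr fun k => ?_
    rw [← integral_sub (pair_int (hv k) hw) (pair_int hvlim hw)]
    refine integral_congr_ae (ae_of_all _ fun x => ?_)
    simp only
    rw [hgs, inner_sub_left]
    ring
  have t1 := hw vlim hvlim
  have t2 := tail_zero hVcont hl hξ hh hw hvlim.1.continuous hvlim.2.1
  have t3 := pair_tendsto hh hw hvlim.1.continuous hvlim.2.1
  have t4 : Tendsto (fun k => ∫ x, (‖gradient vlim x‖ ^ 2 + V (x + ξ k) * vlim x ^ 2)) atTop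
      (𝓝 (normVSq N (fun _ => Vinf) vlim)) := by
    unfold normVSq
    have ib : Integrable fun x => ‖gradient vlim x‖ ^ 2 + (|Vinf| + B) * vlim x ^ 2 :=
      (hvlim.2.2.norm.integrable_sq).add (hvlim.2.1.integrable_sq.const_mul _)
    refine tendsto_integral_of_dominated_convergence _
      (fun k => (norm_int hVcont hB hvlim (ξ k)).aestronglyMeasurable) ib
      (fun k => ae_of_all _ fun x => ?_) (ae_of_all _ fun x => ?_)
    · have h1 := hB (x + ξ k)
      have h2 := abs_add_le (V (x + ξ k) - Vinf) Vinf
      rw [sub_add_cancel] at h2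
      refine (norm_add_le _ _).trans ?_
      rw [norm_mul, Real.norm_eq_abs, Real.norm_eq_abs, Real.norm_eq_abs,
        abs_of_nonneg (sq_nonneg ‖gradient vlim x‖), abs_of_nonneg (sq_nonneg (vlim x))]
      have : |V (x + ξ k)| ≤ |Vinf| + B := by linarith
      have := mul_le_mul_of_nonneg_right this (sq_nonneg (vlim x))
      linarith
    · refine Tendsto.const_add _ (Tendsto.mul_const _ (hl.comp ?_))
      rw [← Metric.cobounded_eq_cocompact, ← tendsto_norm_atTop_iff_cobounded]
      refine tendsto_atTop_mono (fun k => ?_) (tendsto_atTop_add_const_right _ (-‖x‖) hξ)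
      have := norm_sub_le (x + ξ k) x
      rw [add_sub_cancel_left] at this
      linarith
  have tot := ((t1.const_mul 2).add ((t2.const_mul 2).add (t3.const_mul (2 * (Vinf - 1))))).add t4
  simp only [mul_zero, add_zero, zero_add] at tot
  refine tot.congr fun k => ?_
  have ihv : Integrable fun x => (v k x - vlim x) * vlim x := (hh k).2.1.integrable_mul hvlim.2.1
  have iV : Integrable fun x => (V (x + ξ k) - Vinf) * ((v k x - vlim x) * vlim x) :=
    ihv.bdd_mul (c := B) ((hVcont.comp (continuous_id.add continuous_const)).sub
      continuous_const).aestronglyMeasurable (ae_of_all _ fun x => hB _)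
  have ip := pair_int (hh k) hvlim
  unfold normVSq
  rw [← integral_sub (norm_int hVcont hB (hv k) (ξ k)) (norm_int hVcont hB (hh k) (ξ k)),
    ← integral_const_mul, ← integral_const_mul, ← integral_const_mul,
    ← integral_add (iV.const_mul _) (ihv.const_mul _),
    ← integral_add (ip.const_mul _) ((iV.const_mul _).fun_add (ihv.const_mul _)),
    ← integral_add ((ip.const_mul _).fun_add ((iV.const_mul _).fun_add (ihv.const_mul _)))
      (norm_int hVcont hB hvlim (ξ k))]
  refine integral_congr_ae (ae_of_all _ fun x => ?_)
  simp only [Pi.add_apply]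
  rw [hgs, norm_sub_sq_real, inner_sub_left, real_inner_self_eq_norm_sq]
  ring
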